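/- In S = K[x,y,z,w] over a field K, let I = (x²,y) ∩ (x,z) ∩ (z,w). Then S/I is not Cohen–Macaulay, but S/√I = S/((x,y) ∩ (x,z) ∩ (z,w)) is Cohen–Macaulay. -/

import Mathlib

open MvPolynomial

/-- The depth of an `S`-module `M` with respect to an ideal `m`: the supremum of
lengths of `M`-regular sequences consisting of elements of `m`. -/
noncomputable def mDepth (S : Type*) [CommRing S] (m : Ideal S)
    (M : Type*) [AddCommGroup M] [Module S M] : ℕ∞ :=
  sSup {n : ℕ∞ | ∃ rs : List S, (rs.length : ℕ∞) = n ∧ (∀ r ∈ rs, r ∈ m) ∧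
    RingTheory.Sequence.IsRegular M rs}

/-- `M` is a Cohen–Macaulay `S`-module (w.r.t. the ideal `m`) if its depth with
respect to `m` equals its Krull dimension, i.e. the Krull dimension of `S ⧸ ann M`. -/
def IsCM (S : Type*) [CommRing S] (m : Ideal S)
    (M : Type*) [AddCommGroup M] [Module S M] : Prop :=
  (mDepth S m M : WithBot ℕ∞) = ringKrullDim (S ⧸ Module.annihilator S M)

/-- `F` is a prime filtration `I = F₀ ⊆ F₁ ⊆ ... ⊆ F_r = S` with
`F_i/F_{i-1} ≅ S/P_i` for prime ideals `P_i`. -/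
def IsPrimeFiltration {S : Type*} [CommRing S] (I : Ideal S) (r : ℕ)
    (F : Fin (r + 1) → Ideal S) (P : Fin r → Ideal S) : Prop :=
  F 0 = I ∧ F (Fin.last r) = ⊤ ∧ (∀ i : Fin r, F i.castSucc ≤ F i.succ) ∧
  ∀ i : Fin r, (P i).IsPrime ∧
    Nonempty ((↥(Submodule.map (F i.castSucc).mkQ (F i.succ))) ≃ₗ[S] (S ⧸ P i))

/-- `S/I` is clean: it has a prime filtration all of whose primes are minimal
primes of `I`. -/
def IsClean {S : Type*} [CommRing S] (I : Ideal S) : Prop :=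
  ∃ (r : ℕ) (F : Fin (r + 1) → Ideal S) (P : Fin r → Ideal S),
    IsPrimeFiltration I r F P ∧ ∀ i, P i ∈ I.minimalPrimes

/-- `S/I` is pretty clean: it has a prime filtration such that `i ≤ j` and
`P i ⊆ P j` imply `P i = P j`. -/
def IsPrettyClean {S : Type*} [CommRing S] (I : Ideal S) : Prop :=
  ∃ (r : ℕ) (F : Fin (r + 1) → Ideal S) (P : Fin r → Ideal S),
    IsPrimeFiltration I r F P ∧ ∀ i j : Fin r, i ≤ j → P i ≤ P j → P i = P j

/-- A (finitely generated) `S`-module `M` is clean: it has a filtration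
`0 = M₀ ⊆ M₁ ⊆ ... ⊆ M_r = M` with `M_i/M_{i-1} ≅ S/P_i` where each `P_i` is a
minimal prime of the support of `M`, i.e. a minimal prime over `ann M`. -/
def IsCleanModule (S : Type*) [CommRing S] (M : Type*) [AddCommGroup M] [Module S M] : Prop :=
  ∃ (r : ℕ) (F : Fin (r + 1) → Submodule S M) (P : Fin r → Ideal S),
    F 0 = ⊥ ∧ F (Fin.last r) = ⊤ ∧ (∀ i : Fin r, F i.castSucc ≤ F i.succ) ∧
    (∀ i : Fin r, (P i).IsPrime ∧
      Nonempty ((↥(F i.succ) ⧸ (Submodule.comap (F i.succ).subtype (F i.castSucc)))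
        ≃ₗ[S] (S ⧸ P i))) ∧
    ∀ i, P i ∈ (Module.annihilator S M).minimalPrimes

/-- An ideal of a polynomial ring is a monomial ideal if it is generated by monomials. -/
def IsMonomialIdeal {σ K : Type*} [CommSemiring K] (I : Ideal (MvPolynomial σ K)) : Prop :=
  ∃ G : Set (MvPolynomial σ K),
    (∀ g ∈ G, ∃ e : σ →₀ ℕ, g = MvPolynomial.monomial e 1) ∧ I = Ideal.span G

/-- The height of an ideal: the infimum of the heights of the primes containing it. -/
noncomputable def idealHeight {S : Type*} [CommRing S] (I : Ideal S) : ℕ∞ :=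
  sInf {n : ℕ∞ | ∃ q : PrimeSpectrum S, I ≤ q.asIdeal ∧ Order.height q = n}

variable {K : Type*} [Field K]

local notation "S" => MvPolynomial (Fin 4) K
local notation "m4" => (Ideal.span {(X 0 : MvPolynomial (Fin 4) K), X 1, X 2, X 3})

/-- Reducing `R ⧸ I` modulo `r` is the same as passing to `R ⧸ (I + (r))`. -/
noncomputable def quotSMulTopQuotientEquiv {R : Type*} [CommRing R] (I : Ideal R) (r : R) :
    QuotSMulTop r (R ⧸ I) ≃ₗ[R] R ⧸ (I ⊔ Ideal.span {r}) :=
  (Submodule.quotEquivOfEq _ _ (by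
    rw [← Submodule.ideal_span_singleton_smul, ← Submodule.range_mkQ I, ← Submodule.map_top,
      ← Submodule.map_smul'', smul_eq_mul, Ideal.mul_top])).trans
  (Submodule.quotientQuotientEquivQuotientSup I (Ideal.span {r}))

lemma isSMulRegular_quotient_iff {R : Type*} [CommRing R] {I : Ideal R} {r : R} :
    IsSMulRegular (R ⧸ I) r ↔ ∀ f, r * f ∈ I → f ∈ I :=
  isSMulRegular_quotient_iff_mem_of_smul_mem I r

lemma isRegular_quotient_cons_iff {R : Type*} [CommRing R] {I : Ideal R} {r : R} {rs : List R} :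
    RingTheory.Sequence.IsRegular (R ⧸ I) (r :: rs) ↔
      (∀ f, r * f ∈ I → f ∈ I) ∧
        RingTheory.Sequence.IsRegular (R ⧸ (I ⊔ Ideal.span {r})) rs := by
  rw [RingTheory.Sequence.isRegular_cons_iff, isSMulRegular_quotient_iff,
    (quotSMulTopQuotientEquiv I r).isRegular_congr]

lemma ringKrullDim_quotient_sup_span_singleton_add_one_le {R : Type*} [CommRing R] {I : Ideal R}
    {r : R} (h : ∀ f, r * f ∈ I → f ∈ I) :
    ringKrullDim (R ⧸ (I ⊔ Ideal.span {r})) + 1 ≤ ringKrullDim (R ⧸ I) := by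
  refine ringKrullDim_succ_le_of_surjective
    (Ideal.Quotient.factor (le_sup_left : I ≤ I ⊔ Ideal.span {r}))
    (Ideal.Quotient.factor_surjective _) (r := Ideal.Quotient.mk I r) ?_ ?_
  · rw [mem_nonZeroDivisors_iff_right]
    intro f hf
    obtain ⟨f, rfl⟩ := Ideal.Quotient.mk_surjective f
    rw [← map_mul, Ideal.Quotient.eq_zero_iff_mem] at hf
    exact Ideal.Quotient.eq_zero_iff_mem.2 (h f (by rwa [mul_comm]))
  · rw [Ideal.Quotient.factor_mk, Ideal.Quotient.eq_zero_iff_mem]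
    exact Ideal.mem_sup_right (Ideal.mem_span_singleton_self r)

lemma length_le_ringKrullDim_of_isRegular_quotient {R : Type*} [CommRing R] (rs : List R)
    (I : Ideal R) (h : RingTheory.Sequence.IsRegular (R ⧸ I) rs) :
    (rs.length : WithBot ℕ∞) ≤ ringKrullDim (R ⧸ I) := by
  induction rs generalizing I with
  | nil =>
    have := h.nontrivial
    simpa using ringKrullDim_nonneg_of_nontrivial
  | cons r rs ih =>
    rw [isRegular_quotient_cons_iff] at h
    refine le_trans ?_ (ringKrullDim_quotient_sup_span_singleton_add_one_le h.1)
    simpa using add_le_add_left (ih _ h.2) 1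

lemma mDepth_quotient_le_ringKrullDim {R : Type*} [CommRing R] (m I : Ideal R) (hI : I ≠ ⊤) :
    (mDepth R m (R ⧸ I) : WithBot ℕ∞) ≤ ringKrullDim (R ⧸ I) := by
  have := Ideal.Quotient.nontrivial_iff.2 hI
  obtain ⟨d, hd⟩ := WithBot.ne_bot_iff_exists.1 
    (ne_bot_of_le_ne_bot WithBot.coe_ne_bot (ringKrullDim_nonneg_of_nontrivial (R := R ⧸ I)))
  rw [← hd, WithBot.coe_le_coe]
  refine sSup_le ?_
  rintro n ⟨rs, rfl, -, h⟩
  have := length_le_ringKrullDim_of_isRegular_quotient rs I h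
  rw [← hd] at this
  exact_mod_cast this

namespace MvPolynomial

variable {σ R : Type*}

lemma mem_span_X_pow_pair_iff [CommSemiring R] {i j : σ} {a b : ℕ} {f : MvPolynomial σ R} :
    f ∈ Ideal.span {(X i : MvPolynomial σ R) ^ a, X j ^ b} ↔
      ∀ m ∈ f.support, a ≤ m i ∨ b ≤ m j := by
  classical
  have := @mem_ideal_span_monomial_image σ R _ f {Finsupp.single i a, Finsupp.single j b}
  simpa [Set.image_pair, ← X_pow_eq_monomial] using this

lemma mem_span_X_pow_pair_of_X_mul_mem [CommSemiring R] {i j k : σ} {a b : ℕ}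
    {f : MvPolynomial σ R} (hi : k ≠ i) (hj : k ≠ j)
    (h : X k * f ∈ Ideal.span {(X i : MvPolynomial σ R) ^ a, X j ^ b}) :
    f ∈ Ideal.span {(X i : MvPolynomial σ R) ^ a, X j ^ b} := by
  classical
  rw [mem_span_X_pow_pair_iff] at h ⊢
  intro m hm
  have := h (Finsupp.single k 1 + m) (by
    rw [mem_support_iff, coeff_X_mul]; exact mem_support_iff.1 hm)
  simpa [Finsupp.single_apply, hi, hj] using this

lemma mem_span_X_pair_of_X_mul_mem [CommSemiring R] {i j k : σ}
    {f : MvPolynomial σ R} (hi : k ≠ i) (hj : k ≠ j)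
    (h : X k * f ∈ Ideal.span {(X i : MvPolynomial σ R), X j}) :
    f ∈ Ideal.span {(X i : MvPolynomial σ R), X j} := by
  simpa using mem_span_X_pow_pair_of_X_mul_mem (a := 1) (b := 1) hi hj (by simpa using h)

lemma sub_aeval_mem [CommRing R] {Q : Ideal (MvPolynomial σ R)} {g : σ → MvPolynomial σ R}
    (hg : ∀ k, X k - g k ∈ Q) (f : MvPolynomial σ R) : f - aeval g f ∈ Q := by
  have : Ideal.Quotient.mkₐ R Q = (Ideal.Quotient.mkₐ R Q).comp (aeval g) := by
    ext k
    simpa using Ideal.Quotient.eq.2 (hg k)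
  exact Ideal.Quotient.eq.1 (DFunLike.congr_fun this f)

lemma isPrime_span_X_pair [CommRing R] [IsDomain R] (i j : σ) :
    (Ideal.span {(X i : MvPolynomial σ R), X j}).IsPrime := by
  classical
  let φ : MvPolynomial σ R →ₐ[R] MvPolynomial σ R :=
    aeval fun k => if k = i ∨ k = j then 0 else X k
  have hφ : ∀ f, f - φ f ∈ Ideal.span {(X i : MvPolynomial σ R), X j} := by
    refine sub_aeval_mem fun k => ?_
    split_ifs with hk
    · rw [sub_zero]
      rcases hk with rfl | rfl <;> exact Ideal.subset_span (by simp)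
    · simp
  have hker : Ideal.span {(X i : MvPolynomial σ R), X j} = RingHom.ker φ := by
    refine le_antisymm (Ideal.span_le.2 ?_) fun f hf => ?_
    · rintro _ (rfl | rfl) <;> simp [φ]
    · simpa [RingHom.mem_ker.1 hf] using hφ f
  rw [hker]
  exact RingHom.ker_isPrime φ

end MvPolynomial

lemma mem_of_X_one_add_X_two_mul_mem {f : S}
    (h : (X 1 + X 2) * f ∈
      (Ideal.span {X 0, X 1} ⊓ Ideal.span {X 0, X 2} ⊓ Ideal.span {X 2, X 3} : Ideal S)) :
    f ∈ (Ideal.span {X 0, X 1} ⊓ Ideal.span {X 0, X 2} ⊓ Ideal.span {X 2, X 3} : Ideal S) := by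
  obtain ⟨⟨h1, h2⟩, h3⟩ := h
  have e1 : X 2 * f = (X 1 + X 2) * f - f * X 1 := by ring
  have e2 : X 1 * f = (X 1 + X 2) * f - f * X 2 := by ring
  refine ⟨⟨mem_span_X_pair_of_X_mul_mem (k := 2) (by decide) (by decide) ?_,
    mem_span_X_pair_of_X_mul_mem (k := 1) (by decide) (by decide) ?_⟩,
    mem_span_X_pair_of_X_mul_mem (k := 1) (by decide) (by decide) ?_⟩
  · exact e1 ▸ sub_mem h1 (Ideal.mul_mem_left _ _ (Ideal.subset_span (by simp)))
  · exact e2 ▸ sub_mem h2 (Ideal.mul_mem_left _ _ (Ideal.subset_span (by simp)))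
  · exact e2 ▸ sub_mem h3 (Ideal.mul_mem_left _ _ (Ideal.subset_span (by simp)))

lemma mem_of_X_zero_add_X_three_mul_mem {f : S}
    (h : (X 0 + X 3) * f ∈ (Ideal.span {X 0 ^ 1, X 1 ^ 2} ⊓ Ideal.span {X 1, X 3} : Ideal S)) :
    f ∈ (Ideal.span {X 0 ^ 1, X 1 ^ 2} ⊓ Ideal.span {X 1, X 3} : Ideal S) := by
  obtain ⟨h1, h2⟩ := h
  have e1 : X 3 * f = (X 0 + X 3) * f - f * X 0 := by ring
  have e2 : X 0 * f = (X 0 + X 3) * f - f * X 3 := by ring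
  refine ⟨mem_span_X_pow_pair_of_X_mul_mem (k := 3) (by decide) (by decide) ?_,
    mem_span_X_pair_of_X_mul_mem (k := 0) (by decide) (by decide) ?_⟩
  · exact e1 ▸ sub_mem h1 (Ideal.mul_mem_left _ _ (Ideal.subset_span (by simp)))
  · exact e2 ▸ sub_mem h2 (Ideal.mul_mem_left _ _ (Ideal.subset_span (by simp)))

lemma mem_sup_span_X_one_add_X_two_iff {f : S} :
    f ∈ (Ideal.span {X 0, X 1} ⊓ Ideal.span {X 0, X 2} ⊓ Ideal.span {X 2, X 3} : Ideal S) ⊔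
        Ideal.span {X 1 + X 2} ↔
      aeval (fun k : Fin 4 => if k = 2 then -X 1 else (X k : S)) f ∈
        (Ideal.span {X 0 ^ 1, X 1 ^ 2} ⊓ Ideal.span {X 1, X 3} : Ideal S) := by
  set φ : S →ₐ[K] S := aeval (fun k : Fin 4 => if k = 2 then -X 1 else (X k : S)) with hφ
  have φ0 : φ (X 0) = X 0 := by simp [hφ]
  have φ1 : φ (X 1) = X 1 := by simp [hφ]
  have φ2 : φ (X 2) = -X 1 := by simp [hφ]
  have φ3 : φ (X 3) = X 3 := by simp [hφ]
  constructor
  · suffices h : (Ideal.span {X 0, X 1} ⊓ Ideal.span {X 0, X 2} ⊓ Ideal.span {X 2, X 3} :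
        Ideal S) ⊔ Ideal.span {X 1 + X 2} ≤
        (Ideal.span {X 0 ^ 1, X 1 ^ 2} ⊓ Ideal.span {X 1, X 3}).comap φ from fun hf => h hf
    refine sup_le ?_ ?_
    · rintro f ⟨⟨h1, h2⟩, h3⟩
      obtain ⟨a, b, rfl⟩ := Ideal.mem_span_pair.1 h1
      have hb : b ∈ Ideal.span {(X 0 : S), X 2} := by
        refine mem_span_X_pair_of_X_mul_mem (k := 1) (by decide) (by decide) ?_
        have e : X 1 * b = (a * X 0 + b * X 1) - a * X 0 := by ring
        exact e ▸ sub_mem h2 (Ideal.mul_mem_left _ _ (Ideal.subset_span (by simp)))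
      obtain ⟨c, d, rfl⟩ := Ideal.mem_span_pair.1 hb
      obtain ⟨u, v, h⟩ := Ideal.mem_span_pair.1 h3
      refine ⟨Ideal.mem_span_pair.2 ⟨φ a + φ c * X 1, -φ d, ?_⟩,
        Ideal.mem_span_pair.2 ⟨-φ u, φ v, ?_⟩⟩
      · simp only [map_add, map_mul, φ0, φ1, φ2]
        ring
      · simp only [← h, map_add, map_mul, φ2, φ3]
        ring
    · rw [Ideal.span_singleton_le_iff_mem, Ideal.mem_comap, map_add, φ1, φ2, add_neg_cancel]
      exact zero_mem _
  · rintro ⟨h1, h2⟩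
    have hsub : f - φ f ∈ Ideal.span {(X 1 + X 2 : S)} := by
      refine sub_aeval_mem (fun k => ?_) f
      split_ifs with hk
      · rw [hk, sub_neg_eq_add, add_comm]
        exact Ideal.mem_span_singleton_self _
      · simp
    obtain ⟨a, b, hab⟩ := Ideal.mem_span_pair.1 h1
    have ha : a ∈ Ideal.span {(X 1 : S), X 3} := by
      refine mem_span_X_pair_of_X_mul_mem (k := 0) (by decide) (by decide) ?_
      have e : X 0 * a = φ f - b * X 1 * X 1 := by rw [← hab]; ring
      exact e ▸ sub_mem h2 (Ideal.mul_mem_left _ _ (Ideal.subset_span (by simp)))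
    obtain ⟨c, d, rfl⟩ := Ideal.mem_span_pair.1 ha
    have e : f = (d * (X 0 * X 3) - c * (X 0 * X 2) - b * (X 1 * X 2)) +
        ((f - φ f) + (c * X 0 + b * X 1) * (X 1 + X 2)) := by
      rw [← hab]; ring
    rw [e]
    refine Submodule.add_mem_sup ?_
      (add_mem hsub (Ideal.mul_mem_left _ _ (Ideal.mem_span_singleton_self _)))
    refine ⟨⟨Ideal.mem_span_pair.2 ⟨d * X 3 - c * X 2, -b * X 2, ?_⟩,
      Ideal.mem_span_pair.2 ⟨d * X 3 - c * X 2, -b * X 1, ?_⟩⟩,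
      Ideal.mem_span_pair.2 ⟨-c * X 0 - b * X 1, d * X 0, ?_⟩⟩ <;> ring

lemma not_isRegular_pair {a b : S} (ha : a ∈ (m4 : Ideal S)) (hb : b ∈ (m4 : Ideal S))
    {I : Ideal S}
    (hI : I = Ideal.span {X 0 ^ 2, X 1} ⊓ Ideal.span {X 0, X 2} ⊓ Ideal.span {X 2, X 3})
    (hra : ∀ f, a * f ∈ I → f ∈ I)
    (hrb : ∀ f, b * f ∈ I ⊔ Ideal.span {a} → f ∈ I ⊔ Ideal.span {a}) : False := by
  have hmem : ∀ {f}, f ∈ I ↔ (f ∈ Ideal.span {(X 0 : S) ^ 2, X 1} ∧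
      f ∈ Ideal.span {(X 0 : S), X 2}) ∧ f ∈ Ideal.span {(X 2 : S), X 3} := by
    intro f; rw [hI]; rfl
  simp only [Ideal.mem_span_insert, Ideal.mem_span_singleton'] at ha hb
  obtain ⟨a0, _, ⟨a1, _, ⟨a2, _, ⟨a3, rfl⟩, rfl⟩, rfl⟩, ha⟩ := ha
  obtain ⟨b0, _, ⟨b1, _, ⟨b2, _, ⟨b3, rfl⟩, rfl⟩, rfl⟩, hb⟩ := hb
  have key : b * (X 0 * (a2 * X 2 + a3 * X 3)) ∈ I ⊔ Ideal.span {a} := by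
    have e : b * (X 0 * (a2 * X 2 + a3 * X 3)) =
        (b * (X 0 * (a2 * X 2 + a3 * X 3)) - a * (X 0 * (b2 * X 2 + b3 * X 3))) +
          (X 0 * (b2 * X 2 + b3 * X 3)) * a := by ring
    rw [e]
    refine Submodule.add_mem_sup ?_ (Ideal.mul_mem_left _ _ (Ideal.mem_span_singleton_self _))
    refine hmem.2 ⟨⟨Ideal.mem_span_pair.2
      ⟨b0 * (a2 * X 2 + a3 * X 3) - a0 * (b2 * X 2 + b3 * X 3),
        X 0 * (b1 * (a2 * X 2 + a3 * X 3) - a1 * (b2 * X 2 + b3 * X 3)), ?_⟩,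
      Ideal.mem_span_pair.2 ⟨b * (a2 * X 2 + a3 * X 3) - a * (b2 * X 2 + b3 * X 3), 0, ?_⟩⟩,
      Ideal.mem_span_pair.2
      ⟨b * (X 0 * a2) - a * (X 0 * b2), b * (X 0 * a3) - a * (X 0 * b3), ?_⟩⟩
    · rw [ha, hb]; ring
    · ring
    · ring
  obtain ⟨i, hi, _, hj, hij⟩ := Submodule.mem_sup.1 (hrb _ key)
  obtain ⟨h, rfl⟩ := Ideal.mem_span_singleton'.1 hj
  obtain ⟨⟨hi1, hi2⟩, hi3⟩ := hmem.1 hi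
  have hh : h ∈ Ideal.span {(X 2 : S), X 3} := by
    refine mem_span_X_pair_of_X_mul_mem (k := 1) (by decide) (by decide)
      (hmem.1 (hra (X 1 * h) (hmem.2 ⟨⟨?_, ?_⟩, ?_⟩))).2
    · exact Ideal.mem_span_pair.2 ⟨0, a * h, by ring⟩
    · have e : a * (X 1 * h) = X 1 * (a2 * X 2 + a3 * X 3) * X 0 - X 1 * i := by
        linear_combination X 1 * hij
      exact e ▸ sub_mem (Ideal.mul_mem_left _ _ (Ideal.subset_span (by simp)))
        (Ideal.mul_mem_left _ _ hi2)
    · have e : a * (X 1 * h) = (X 1 * X 0 * a2 * X 2 + X 1 * X 0 * a3 * X 3) - X 1 * i := by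
        linear_combination X 1 * hij
      exact e ▸ sub_mem (Ideal.mem_span_pair.2 ⟨_, _, rfl⟩) (Ideal.mul_mem_left _ _ hi3)
  have hx : h - X 0 ∈ Ideal.span {(X 0 : S) ^ 2, X 1 ^ 1} := by
    refine mem_span_X_pow_pair_of_X_mul_mem (k := 2) (by decide) (by decide) ?_
    rw [pow_one]
    refine (hmem.1 (hra _ (hmem.2 ⟨⟨?_, ?_⟩, ?_⟩))).1.1
    · have e : a * (X 2 * (h - X 0)) =
          ((-X 2 * a0) * X 0 ^ 2 + (-X 2 * X 0 * a1) * X 1) - X 2 * i := by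
        linear_combination X 2 * hij - X 2 * X 0 * ha
      exact e ▸ sub_mem (Ideal.mem_span_pair.2 ⟨_, _, rfl⟩) (Ideal.mul_mem_left _ _ hi1)
    · exact Ideal.mem_span_pair.2 ⟨0, a * (h - X 0), by ring⟩
    · exact Ideal.mem_span_pair.2 ⟨a * (h - X 0), 0, by ring⟩
  rw [← pow_one (X 2), ← pow_one (X 3), mem_span_X_pow_pair_iff] at hh
  rw [mem_span_X_pow_pair_iff] at hx
  have h1 : coeff (Finsupp.single 0 1) h = 0 := by
    by_contra hne
    simpa using hh _ (mem_support_iff.2 hne)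
  have h2 : coeff (Finsupp.single 0 1) (h - X 0) = 0 := by
    by_contra hne
    simpa using hx _ (mem_support_iff.2 hne)
  simp [h1] at h2

lemma ringKrullDim_quotient_le_two {J : Ideal S} (h1 : X 0 * X 2 ∈ J)
    (h2 : X 0 * X 3 + X 1 * X 2 ∈ J) : ringKrullDim (S ⧸ J) ≤ 2 := by
  have hX : ∀ {i j : Fin 4}, i ≠ j → ¬ (X i : S) ∣ X j := fun hij h => hij (by simpa using h)
  have d1 := ringKrullDim_quotient_sup_span_singleton_add_one_le (I := (⊥ : Ideal S))
    (r := X 0 * X 2) (by simp)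
  have d2 := ringKrullDim_quotient_sup_span_singleton_add_one_le
    (I := (⊥ : Ideal S) ⊔ Ideal.span {X 0 * X 2}) (r := X 0 * X 3 + X 1 * X 2) (by
      intro f hf
      rw [bot_sup_eq, Ideal.mem_span_singleton] at hf ⊢
      obtain ⟨g, hg⟩ := hf
      have h0 : (X 0 : S) ∣ X 1 * X 2 * f := ⟨X 2 * g - X 3 * f, by linear_combination hg⟩
      have h0 : (X 0 : S) ∣ f := by
        rcases X_prime.dvd_or_dvd h0 with h0 | h0
        · rcases X_prime.dvd_or_dvd h0 with h0 | h0 <;> exact absurd h0 (hX (by decide))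
        · exact h0
      obtain ⟨f, rfl⟩ := h0
      refine mul_dvd_mul_left _ ?_
      have h2 : (X 2 : S) ∣ X 0 * X 3 * (X 0 * f) :=
        ⟨X 0 * g - X 1 * (X 0 * f), by linear_combination hg⟩
      rcases X_prime.dvd_or_dvd h2 with h2 | h2
      · rcases X_prime.dvd_or_dvd h2 with h2 | h2 <;> exact absurd h2 (hX (by decide))
      · exact (X_prime.dvd_or_dvd h2).resolve_left (hX (by decide)))
  have hle : (⊥ : Ideal S) ⊔ Ideal.span {X 0 * X 2} ⊔ Ideal.span {X 0 * X 3 + X 1 * X 2} ≤ J := by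
    simp [h1, h2]
  have d3 := ringKrullDim_le_of_surjective (Ideal.Quotient.factor hle)
    (Ideal.Quotient.factor_surjective hle)
  have d4 : ringKrullDim (S ⧸ (⊥ : Ideal S)) ≤ 4 := by
    refine (ringKrullDim_le_of_surjective (Ideal.Quotient.mk _)
      Ideal.Quotient.mk_surjective).trans ?_
    simp [MvPolynomial.ringKrullDim_of_isNoetherianRing]
  refine d3.trans ?_
  have d5 := (add_le_add_left d2 1).trans (d1.trans d4)
  generalize ringKrullDim (S ⧸ ((⊥ : Ideal S) ⊔ Ideal.span {X 0 * X 2} ⊔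
    Ideal.span {X 0 * X 3 + X 1 * X 2})) = d at d5 ⊢
  induction d with
  | bot => exact bot_le
  | coe d =>
    induction d with
    | top => exact absurd d5 (by decide)
    | coe d =>
      have h : d + 1 + 1 ≤ 4 :=
        Nat.cast_le.1 (WithBot.coe_le_coe.1 d5 : ((d + 1 + 1 : ℕ) : ℕ∞) ≤ (4 : ℕ))
      exact WithBot.coe_le_coe.2 (Nat.cast_le.2 (by omega : d ≤ 2))

/-- For `I = (x²,y) ∩ (x,z) ∩ (z,w)` in `S = K[x,y,z,w]`,
`S/I` is not Cohen–Macaulay, but `S/√I = S/((x,y) ∩ (x,z) ∩ (z,w))` is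
Cohen–Macaulay. -/
theorem stmt_10 (I : Ideal S)
    (hI : I = Ideal.span {X 0 ^ 2, X 1} ⊓ Ideal.span {X 0, X 2} ⊓ Ideal.span {X 2, X 3}) :
    I.radical = Ideal.span {X 0, X 1} ⊓ Ideal.span {X 0, X 2} ⊓ Ideal.span {X 2, X 3} ∧
    ¬ IsCM S m4 (S ⧸ I) ∧ IsCM S m4 (S ⧸ I.radical) := by
  have hrad : I.radical =
      Ideal.span {X 0, X 1} ⊓ Ideal.span {X 0, X 2} ⊓ Ideal.span {X 2, X 3} := by
    have h : (Ideal.span {(X 0 : S) ^ 2, X 1}).radical = Ideal.span {X 0, X 1} := by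
      refine le_antisymm ((isPrime_span_X_pair 0 1).radical_le_iff.2 (Ideal.span_le.2 ?_))
        (Ideal.span_le.2 ?_)
      · rintro _ (rfl | rfl)
        · exact Ideal.pow_mem_of_mem _ (Ideal.subset_span (by simp)) _ two_pos
        · exact Ideal.subset_span (by simp)
      · rintro _ (rfl | rfl)
        · exact ⟨2, Ideal.subset_span (by simp)⟩
        · exact Ideal.le_radical (Ideal.subset_span (by simp))
    rw [hI, Ideal.radical_inf, Ideal.radical_inf, h, (isPrime_span_X_pair 0 2).radical,
      (isPrime_span_X_pair 2 3).radical]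
  refine ⟨hrad, ?_⟩
  have hJm : I.radical ≤ RingHom.ker (constantCoeff (σ := Fin 4) (R := K)) := by
    rw [hrad]
    refine inf_le_right.trans (Ideal.span_le.2 ?_)
    rintro _ (rfl | rfl) <;> simp
  have hJ : I.radical ≠ ⊤ := fun h => by
    rw [h, top_le_iff] at hJm
    exact RingHom.ker_ne_top _ hJm
  have hreg : RingTheory.Sequence.IsRegular (S ⧸ I.radical) [(X 1 + X 2 : S), X 0 + X 3] := by
    rw [isRegular_quotient_cons_iff, isRegular_quotient_cons_iff]
    refine ⟨fun f hf => ?_, fun f hf => ?_, ?_⟩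
    · rw [hrad] at hf ⊢
      exact mem_of_X_one_add_X_two_mul_mem hf
    · rw [hrad, mem_sup_span_X_one_add_X_two_iff] at hf ⊢
      refine mem_of_X_zero_add_X_three_mul_mem ?_
      simpa using hf
    · have : Nontrivial (S ⧸ (I.radical ⊔ Ideal.span {X 1 + X 2} ⊔ Ideal.span {X 0 + X 3})) := by
        refine Ideal.Quotient.nontrivial_iff.2 (ne_top_of_le_ne_top
          (RingHom.ker_ne_top (constantCoeff (σ := Fin 4) (R := K))) (sup_le (sup_le hJm ?_) ?_))
        · simp
        · simp
      exact RingTheory.Sequence.IsRegular.nil _ _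
  have hdim : 2 ≤ ringKrullDim (S ⧸ I.radical) := by
    simpa using length_le_ringKrullDim_of_isRegular_quotient _ _ hreg
  constructor
  · intro hCM
    rw [IsCM, Ideal.annihilator_quotient] at hCM
    have hle : (2 : WithBot ℕ∞) ≤ mDepth S m4 (S ⧸ I) := hCM ▸ hdim.trans
      (ringKrullDim_le_of_surjective (Ideal.Quotient.factor Ideal.le_radical)
        (Ideal.Quotient.factor_surjective _))
    have hlt : (1 : ℕ∞) < mDepth S m4 (S ⧸ I) :=
      lt_of_lt_of_le (by norm_num) (WithBot.coe_le_coe.1 hle)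
    obtain ⟨n, ⟨rs, rfl, hrs, h⟩, hn⟩ := lt_sSup_iff.1 hlt
    match rs, hn, hrs, h with
    | [], hn, _, _ => simp at hn
    | [_], hn, _, _ => simp at hn
    | a :: b :: rs, _, hrs, h =>
      rw [isRegular_quotient_cons_iff, isRegular_quotient_cons_iff] at h
      exact not_isRegular_pair (hrs a (by simp)) (hrs b (by simp)) hI h.1 h.2.1
  · rw [IsCM, Ideal.annihilator_quotient]
    refine le_antisymm (mDepth_quotient_le_ringKrullDim _ _ hJ) ?_
    refine (ringKrullDim_quotient_le_two ?_ ?_).trans ?_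
    · rw [hrad]
      exact ⟨⟨Ideal.mem_span_pair.2 ⟨X 2, 0, by ring⟩, Ideal.mem_span_pair.2 ⟨X 2, 0, by ring⟩⟩,
        Ideal.mem_span_pair.2 ⟨X 0, 0, by ring⟩⟩
    · rw [hrad]
      exact ⟨⟨Ideal.mem_span_pair.2 ⟨X 3, X 2, by ring⟩,
        Ideal.mem_span_pair.2 ⟨X 3, X 1, by ring⟩⟩, Ideal.mem_span_pair.2 ⟨X 1, X 0, by ring⟩⟩
    · refine WithBot.coe_le_coe.2 (le_sSup ⟨[X 1 + X 2, X 0 + X 3], rfl, ?_, hreg⟩)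
      intro r hr
      simp only [List.mem_cons, List.not_mem_nil, or_false] at hr
      rcases hr with rfl | rfl <;>
        exact add_mem (Ideal.subset_span (by simp)) (Ideal.subset_span (by simp))
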